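/- arXiv:1710.09333 — 2 statements merged into one kernel-verified Lean document; each statement's English description precedes it below -/
import Mathlib

section
/- Let 0 < μ ≤ μ_ℝ and let u : ℝ → ℝ be continuously differentiable with derivative u', with u and u' square-integrable on ℝ and ∫_ℝ u(x)² dx = μ. Then the critical NLS energy satisfies the lower bound E_6(u, ℝ) ≥ (1/2)·(1 − μ²/μ_ℝ²)·∫_ℝ u'(x)² dx; in particular E_6(u, ℝ) ≥ 0. -/
open MeasureTheory Filter Topology Set

/-- Signed area under the unit semicircle from `0` to `s`. -/
noncomputable def semicirclePrimitive (s : ℝ) : ℝ := ∫ t in (0 : ℝ)..s, Real.sqrt (1 - t ^ 2)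

theorem hasDerivAt_semicirclePrimitive (s : ℝ) :
    HasDerivAt semicirclePrimitive (Real.sqrt (1 - s ^ 2)) s := by
  have hc : Continuous fun t : ℝ => Real.sqrt (1 - t ^ 2) := by fun_prop
  exact intervalIntegral.integral_hasDerivAt_right (hc.intervalIntegrable _ _)
    (hc.stronglyMeasurableAtFilter _ _) hc.continuousAt

theorem semicirclePrimitive_zero : semicirclePrimitive 0 = 0 := by
  simp [semicirclePrimitive]

theorem semicirclePrimitive_one : semicirclePrimitive 1 = Real.pi / 4 := by
  have hc : Continuous fun t : ℝ => Real.sqrt (1 - t ^ 2) := by fun_prop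
  have h := intervalIntegral.integral_comp_neg (a := 0) (b := 1)
    (fun t : ℝ => Real.sqrt (1 - t ^ 2))
  simp only [neg_sq, neg_zero] at h
  have hadd := intervalIntegral.integral_add_adjacent_intervals
    (hc.intervalIntegrable (-1) 0 (μ := volume)) (hc.intervalIntegrable 0 1)
  rw [integral_sqrt_one_sub_sq] at hadd
  unfold semicirclePrimitive
  linarith

theorem integrable_mul_of_integrable_sq {f g : ℝ → ℝ} (hf : Continuous f) (hg : Continuous g)
    (hf2 : Integrable fun x => f x ^ 2) (hg2 : Integrable fun x => g x ^ 2) :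
    Integrable fun x => f x * g x := by
  refine (hf2.add hg2).mono' (hf.mul hg).aestronglyMeasurable (.of_forall fun x => ?_)
  rw [Real.norm_eq_abs, abs_le, Pi.add_apply]
  constructor <;> nlinarith [sq_nonneg (f x + g x), sq_nonneg (f x - g x), sq_nonneg (f x),
    sq_nonneg (g x)]

section GagliardoNirenberg

variable {u u' : ℝ → ℝ}

theorem hasDerivAt_sq_of_hasDerivAt (hderiv : ∀ x, HasDerivAt u (u' x) x) (x : ℝ) :
    HasDerivAt (fun y => u y ^ 2) (2 * (u x * u' x)) x := by
  exact ((hderiv x).fun_pow 2).congr_deriv (by ring)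

theorem tendsto_sq_zero_of_integrable (hderiv : ∀ x, HasDerivAt u (u' x) x)
    (hcont : Continuous u') (hu2 : Integrable fun x => u x ^ 2)
    (hu'2 : Integrable fun x => u' x ^ 2) :
    Tendsto (fun x => u x ^ 2) atBot (𝓝 0) ∧ Tendsto (fun x => u x ^ 2) atTop (𝓝 0) := by
  have hu : Continuous u := continuous_iff_continuousAt.2 fun x => (hderiv x).continuousAt
  have hint : Integrable fun x => 2 * (u x * u' x) :=
    (integrable_mul_of_integrable_sq hu hcont hu2 hu'2).const_mul 2
  exact ⟨tendsto_zero_of_hasDerivAt_of_integrableOn_Iic (a := 0)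
      (fun x _ => hasDerivAt_sq_of_hasDerivAt hderiv x) hint.integrableOn hu2.integrableOn,
    tendsto_zero_of_hasDerivAt_of_integrableOn_Ioi (a := 0)
      (fun x _ => hasDerivAt_sq_of_hasDerivAt hderiv x) hint.integrableOn hu2.integrableOn⟩

/-- The sharp Gagliardo–Nirenberg inequality for the `L⁶` norm on the real line. -/
theorem pi_sq_mul_integral_pow_six_le (hderiv : ∀ x, HasDerivAt u (u' x) x)
    (hcont : Continuous u') (hu2 : Integrable fun x => u x ^ 2)
    (hu'2 : Integrable fun x => u' x ^ 2) (hpos : 0 < ∫ x, u x ^ 2) :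
    Real.pi ^ 2 * ∫ x, u x ^ 6 ≤ 4 * (∫ x, u x ^ 2) ^ 2 * ∫ x, u' x ^ 2 := by
  have hu : Continuous u := continuous_iff_continuousAt.2 fun x => (hderiv x).continuousAt
  obtain ⟨hbot, htop⟩ := tendsto_sq_zero_of_integrable hderiv hcont hu2 hu'2
  obtain ⟨x₁, hx₁⟩ : ∃ x, 0 < u x ^ 2 := by
    by_contra! h
    exact hpos.not_ge (integral_nonpos h)
  obtain ⟨x₀, hmax⟩ : ∃ x₀, ∀ x, u x ^ 2 ≤ u x₀ ^ 2 := by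
    refine (hu.pow 2).exists_forall_ge' x₁ ?_
    rw [cocompact_eq_atBot_atTop]
    exact eventually_sup.2 ⟨hbot.eventually (ge_mem_nhds hx₁), htop.eventually (ge_mem_nhds hx₁)⟩
  set A : ℝ := u x₀ ^ 2 with hA
  have hA0 : 0 < A := hx₁.trans_le (hmax x₁)
  set μ : ℝ := ∫ x, u x ^ 2 with hμ
  set r : ℝ → ℝ := fun x => Real.sqrt (1 - (u x ^ 2 / A) ^ 2) with hr
  have hrc : Continuous r := by fun_prop
  have hr0 : ∀ x, 0 ≤ r x := fun x => Real.sqrt_nonneg _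
  have hr1 : ∀ x, r x ≤ 1 := fun x => Real.sqrt_le_one.2 (by nlinarith [sq_nonneg (u x ^ 2 / A)])
  have hrsq : ∀ x, A ^ 2 * r x ^ 2 = A ^ 2 - u x ^ 4 := fun x => by
    have hw : u x ^ 2 / A ≤ 1 := (div_le_one hA0).2 (hmax x)
    have hw0 : 0 ≤ u x ^ 2 / A := by positivity
    rw [hr, Real.sq_sqrt (by nlinarith)]
    field_simp
  set G : ℝ → ℝ := fun x => A ^ 2 * semicirclePrimitive (u x ^ 2 / A) with hG
  set g : ℝ → ℝ := fun x => 2 * A * (r x * (u x * u' x)) with hg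
  have hGd : ∀ x, HasDerivAt G (g x) x := fun x => by
    have h := ((hasDerivAt_semicirclePrimitive (u x ^ 2 / A)).comp x
      ((hasDerivAt_sq_of_hasDerivAt hderiv x).div_const A)).const_mul (A ^ 2)
    refine h.congr_deriv ?_
    simp only [hg, hr]
    field_simp
  have hgi : Integrable g := by
    refine Integrable.const_mul ?_ _
    refine (integrable_mul_of_integrable_sq hu hcont hu2 hu'2).bdd_mul (c := 1)
      hrc.aestronglyMeasurable (.of_forall fun x => ?_)
    rw [Real.norm_of_nonneg (hr0 x)]
    exact hr1 x
  have hGlim : ∀ l : Filter ℝ, Tendsto (fun x => u x ^ 2) l (𝓝 0) → Tendsto G l (𝓝 0) := by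
    intro l hl
    have h := ((hasDerivAt_semicirclePrimitive 0).continuousAt.tendsto.comp
      (by simpa using hl.div_const A)).const_mul (A ^ 2)
    simpa [semicirclePrimitive_zero] using h
  have hGx₀ : G x₀ = A ^ 2 * (Real.pi / 4) := by
    simp only [hG, ← hA, div_self hA0.ne', semicirclePrimitive_one]
  have hleft : ∫ x in Iic x₀, g x = A ^ 2 * (Real.pi / 4) := by
    rw [integral_Iic_of_hasDerivAt_of_tendsto' (fun x _ => hGd x) hgi.integrableOn
      (hGlim _ hbot), hGx₀, sub_zero]
  have hright : ∫ x in Ioi x₀, g x = -(A ^ 2 * (Real.pi / 4)) := by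
    rw [integral_Ioi_of_hasDerivAt_of_tendsto' (fun x _ => hGd x) hgi.integrableOn
      (hGlim _ htop), hGx₀, zero_sub]
  have hu6 : Integrable fun x => u x ^ 6 := by
    refine (hu2.const_mul (A ^ 2)).mono' (hu.pow 6).aestronglyMeasurable (.of_forall fun x => ?_)
    rw [Real.norm_of_nonneg (by positivity)]
    nlinarith [mul_nonneg (sq_nonneg (A * r x)) (sq_nonneg (u x)), hrsq x]
  set c : ℝ := Real.pi / (2 * μ) with hc
  set F : ℝ → ℝ := fun x => u' x ^ 2 + c ^ 2 * (A ^ 2 * u x ^ 2 - u x ^ 6) with hF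
  have hpot : Integrable fun x => c ^ 2 * (A ^ 2 * u x ^ 2 - u x ^ 6) :=
    ((hu2.const_mul _).sub hu6).const_mul _
  have hFi : Integrable F := hu'2.add hpot
  have hFint : ∫ x, F x = (∫ x, u' x ^ 2) + c ^ 2 * (A ^ 2 * μ - ∫ x, u x ^ 6) := by
    simp only [hF]
    rw [integral_add hu'2 hpot, integral_const_mul,
      integral_sub (hu2.const_mul _) hu6, integral_const_mul]
  have hFsq : ∀ x, F x = u' x ^ 2 + (c * (A * r x * u x)) ^ 2 := fun x => by
    simp only [hF]
    linear_combination (-c ^ 2 * u x ^ 2) * hrsq x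
  have hleft' : c * (A ^ 2 * (Real.pi / 4)) ≤ ∫ x in Iic x₀, F x := by
    rw [← hleft, ← integral_const_mul]
    refine integral_mono (hgi.const_mul c).integrableOn hFi.integrableOn fun x => ?_
    simp only [hFsq, hg]
    nlinarith [sq_nonneg (u' x - c * (A * r x * u x))]
  have hright' : c * (A ^ 2 * (Real.pi / 4)) ≤ ∫ x in Ioi x₀, F x := by
    rw [← neg_neg (A ^ 2 * (Real.pi / 4)), ← hright, ← integral_neg, ← integral_const_mul]
    refine integral_mono (hgi.neg.const_mul c).integrableOn hFi.integrableOn fun x => ?_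
    simp only [hFsq, hg]
    nlinarith [sq_nonneg (u' x + c * (A * r x * u x))]
  have hsplit := intervalIntegral.integral_Iic_add_Ioi (b := x₀) hFi.integrableOn hFi.integrableOn
  have hcμ : c * (2 * μ) = Real.pi := by
    rw [hc]
    field_simp
  have hkey : c ^ 2 * ∫ x, u x ^ 6 ≤ ∫ x, u' x ^ 2 := by
    have : c * (A ^ 2 * (Real.pi / 4)) * 2 = c ^ 2 * (A ^ 2 * μ) := by
      rw [← hcμ]
      ring
    linarith
  calc Real.pi ^ 2 * ∫ x, u x ^ 6 = 4 * μ ^ 2 * (c ^ 2 * ∫ x, u x ^ 6) := by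
        rw [← hcμ]
        ring
    _ ≤ 4 * μ ^ 2 * ∫ x, u' x ^ 2 := by gcongr

end GagliardoNirenberg

/-- For `0 < μ ≤ μ_ℝ = √3 π / 2` and `u` continuously differentiable with `u, u'`
square-integrable on ℝ and mass `∫ u² = μ`, the critical NLS energy satisfies
`E_6(u,ℝ) ≥ (1/2)(1 − μ²/μ_ℝ²) ∫ (u')²`; in particular `E_6(u,ℝ) ≥ 0`. -/
theorem critical_energy_lower_bound_line
    (μ : ℝ) (hμ0 : 0 < μ) (hμ : μ ≤ Real.sqrt 3 * Real.pi / 2)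
    (u u' : ℝ → ℝ)
    (hderiv : ∀ x, HasDerivAt u (u' x) x)
    (hcont : Continuous u')
    (hu2 : Integrable (fun x => u x ^ 2))
    (hu'2 : Integrable (fun x => u' x ^ 2))
    (hmass : ∫ x, u x ^ 2 = μ) :
    (1 / 2) * (∫ x, u' x ^ 2) - (1 / 6) * (∫ x, |u x| ^ 6) ≥
      (1 / 2) * (1 - μ ^ 2 / (Real.sqrt 3 * Real.pi / 2) ^ 2) * ∫ x, u' x ^ 2 ∧
    (1 / 2) * (∫ x, u' x ^ 2) - (1 / 6) * (∫ x, |u x| ^ 6) ≥ 0 := by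
  have hGN := pi_sq_mul_integral_pow_six_le hderiv hcont hu2 hu'2 (hmass ▸ hμ0)
  rw [hmass] at hGN
  have habs : ∫ x, |u x| ^ 6 = ∫ x, u x ^ 6 := by
    congr 1 with x
    exact Even.pow_abs (by decide) _
  have hD : 0 ≤ ∫ x, u' x ^ 2 := integral_nonneg fun x => sq_nonneg _
  have hcrit : (Real.sqrt 3 * Real.pi / 2) ^ 2 = 3 * Real.pi ^ 2 / 4 := by
    rw [div_pow, mul_pow, Real.sq_sqrt (by norm_num)]
    norm_num
  have hπ := Real.pi_pos
  have hbound : (1 / 2) * (∫ x, u' x ^ 2) - (1 / 6) * (∫ x, |u x| ^ 6) ≥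
      (1 / 2) * (1 - μ ^ 2 / (Real.sqrt 3 * Real.pi / 2) ^ 2) * ∫ x, u' x ^ 2 := by
    have h : ∫ x, u x ^ 6 ≤ 4 * μ ^ 2 * (∫ x, u' x ^ 2) / Real.pi ^ 2 :=
      (le_div_iff₀' (by positivity)).2 hGN
    have h' : μ ^ 2 / (3 * Real.pi ^ 2 / 4) * (∫ x, u' x ^ 2) =
        4 * μ ^ 2 * (∫ x, u' x ^ 2) / Real.pi ^ 2 / 3 := by
      field_simp
    rw [habs, hcrit]
    linarith
  refine ⟨hbound, hbound.trans' ?_⟩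
  have hratio : μ ^ 2 / (Real.sqrt 3 * Real.pi / 2) ^ 2 ≤ 1 :=
    div_le_one_of_le₀ (by gcongr) (sq_nonneg _)
  exact mul_nonneg (by linarith) hD
end

section
/- For every μ with 0 < μ ≤ μ_ℝ, the infimum of the critical NLS energy over all admissible functions of mass μ on the line is zero: every continuously differentiable u : ℝ → ℝ with u, u' square-integrable and ∫_ℝ u² dx = μ has E_6(u, ℝ) ≥ 0, and for every ε > 0 there exists such a u with E_6(u, ℝ) < ε. -/
open MeasureTheory

/-- A function with `u` and `u'` square-integrable on the line is bounded. -/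
lemma exists_abs_le_of_integrable_sq {u u' : ℝ → ℝ} (hu : ∀ x, HasDerivAt u (u' x) x)
    (hu' : Continuous u') (h2 : Integrable (fun x => u x ^ 2))
    (h2' : Integrable (fun x => u' x ^ 2)) : ∃ C, ∀ x, u x ^ 2 ≤ C := by
  have hc : Continuous u := continuous_iff_continuousAt.2 fun x => (hu x).continuousAt
  have hd : ∀ x, HasDerivAt (fun y => u y ^ 2) (2 * u x * u' x) x := fun x => by
    simpa using (hu x).fun_pow 2
  have hi : Integrable (fun x => 2 * u x * u' x) := by
    refine (h2.add h2').mono' (by fun_prop) (.of_forall fun x => ?_)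
    rw [Real.norm_eq_abs, abs_le]
    constructor <;> simp only [Pi.add_apply] <;>
      nlinarith [sq_nonneg (u x + u' x), sq_nonneg (u x - u' x)]
  refine ⟨u 0 ^ 2 + ∫ x, ‖2 * u x * u' x‖, fun x => ?_⟩
  have h := intervalIntegral.integral_eq_sub_of_hasDerivAt (a := 0) (b := x)
    (fun y _ => hd y) hi.intervalIntegrable
  have h₁ := intervalIntegral.norm_integral_le_integral_norm_uIoc
    (f := fun x => 2 * u x * u' x) (a := 0) (b := x) (μ := volume)
  have h₂ : ∫ y in Set.uIoc 0 x, ‖2 * u y * u' y‖ ≤ ∫ y, ‖2 * u y * u' y‖ :=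
    setIntegral_le_integral hi.norm (.of_forall fun y => norm_nonneg _)
  rw [h, Real.norm_eq_abs] at h₁
  linarith [le_abs_self (u x ^ 2 - u 0 ^ 2)]

/-- The sharp critical Gagliardo–Nirenberg inequality on the line, away from the endpoint:
it follows by expanding the square of `u' + (α / 2) u ^ 3 tan θ`, where `θ' = α u ^ 2`. -/
lemma sq_mul_integral_pow_six_le {u u' : ℝ → ℝ} (hu : ∀ x, HasDerivAt u (u' x) x)
    (hu' : Continuous u') (h2 : Integrable (fun x => u x ^ 2))
    (h2' : Integrable (fun x => u' x ^ 2)) {α : ℝ} (hα : 0 ≤ α)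
    (hαμ : α * (∫ x, u x ^ 2) < Real.pi) :
    α ^ 2 / 4 * (∫ x, u x ^ 6) ≤ ∫ x, u' x ^ 2 := by
  have hc : Continuous u := continuous_iff_continuousAt.2 fun x => (hu x).continuousAt
  obtain ⟨C, hC⟩ := exists_abs_le_of_integrable_sq hu hu' h2 h2'
  have hC0 : 0 ≤ C := (sq_nonneg _).trans (hC 0)
  set μ := ∫ x, u x ^ 2 with hμ
  set m : ℝ → ℝ := fun x => ∫ t in Set.Iic x, u t ^ 2 with hm
  have hm0 : ∀ x, 0 ≤ m x := fun x => integral_nonneg fun _ => sq_nonneg _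
  have hmμ : ∀ x, m x ≤ μ := fun x =>
    setIntegral_le_integral h2 (.of_forall fun y => sq_nonneg _)
  have hm' : ∀ x, HasDerivAt m (u x ^ 2) x := fun x => by
    have h : m = fun y => m 0 + ∫ t in (0 : ℝ)..y, u t ^ 2 := by
      funext y
      rw [← intervalIntegral.integral_Iic_sub_Iic h2.integrableOn h2.integrableOn]
      simp [hm]
    rw [h]
    exact ((hc.pow 2).integral_hasStrictDerivAt 0 x).hasDerivAt.const_add _
  set θ : ℝ → ℝ := fun x => α * (m x - μ / 2) with hθ
  set b := α * μ / 2 with hb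
  have hbπ : b < Real.pi / 2 := by rw [hb]; linarith
  have hθ1 : ∀ x, -b ≤ θ x := fun x => by
    have := mul_nonneg hα (hm0 x); simp only [hθ, hb]; linarith
  have hθ2 : ∀ x, θ x ≤ b := fun x => by
    have := mul_le_mul_of_nonneg_left (hmμ x) hα; simp only [hθ, hb]; linarith
  have hcos : ∀ x, Real.cos (θ x) ≠ 0 := fun x =>
    (Real.cos_pos_of_mem_Ioo ⟨by linarith [hθ1 x], by linarith [hθ2 x]⟩).ne'
  have hθ' : ∀ x, HasDerivAt θ (α * u x ^ 2) x := fun x =>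
    ((hm' x).sub_const _).const_mul α
  set T : ℝ → ℝ := fun x => Real.tan (θ x) with hT
  have hT' : ∀ x, HasDerivAt T ((1 + T x ^ 2) * (α * u x ^ 2)) x := fun x => by
    have h := (Real.hasDerivAt_tan (hcos x)).comp x (hθ' x)
    rwa [one_div, ← Real.inv_one_add_tan_sq (hcos x), inv_inv] at h
  have hTc : Continuous T := continuous_iff_continuousAt.2 fun x => (hT' x).continuousAt
  set B := Real.tan b with hB
  have hTB : ∀ x, |T x| ≤ B := fun x => by
    have hmono := Real.strictMonoOn_tan.monotoneOn
    have hmem : θ x ∈ Set.Ioo (-(Real.pi / 2)) (Real.pi / 2) :=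
      ⟨by linarith [hθ1 x], by linarith [hθ2 x]⟩
    have hb' : b ∈ Set.Ioo (-(Real.pi / 2)) (Real.pi / 2) :=
      ⟨by linarith [hθ1 x, hθ2 x], hbπ⟩
    have hnb : -b ∈ Set.Ioo (-(Real.pi / 2)) (Real.pi / 2) :=
      ⟨by linarith, by linarith [hb'.1]⟩
    rw [abs_le, hB, ← Real.tan_neg]
    exact ⟨hmono hnb hmem (hθ1 x), hmono hmem hb' (hθ2 x)⟩
  have hTB2 : ∀ x, T x ^ 2 ≤ B ^ 2 := fun x => by
    rw [← sq_abs]; exact pow_le_pow_left₀ (abs_nonneg _) (hTB x) 2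
  have h4 : ∀ x, u x ^ 4 ≤ C * u x ^ 2 := fun x => by
    nlinarith [mul_le_mul_of_nonneg_right (hC x) (sq_nonneg (u x))]
  have h6 : ∀ x, u x ^ 6 ≤ C ^ 2 * u x ^ 2 := fun x => by
    nlinarith [mul_le_mul_of_nonneg_right (h4 x) (sq_nonneg (u x)),
      mul_le_mul_of_nonneg_left (h4 x) hC0]
  have i6 : Integrable (fun x => u x ^ 6) := by
    refine (h2.const_mul (C ^ 2)).mono' (by fun_prop) (.of_forall fun x => ?_)
    rw [Real.norm_of_nonneg (by positivity)]
    exact h6 x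
  have i6T : Integrable (fun x => T x ^ 2 * u x ^ 6) := by
    refine (i6.const_mul (B ^ 2)).mono' (by fun_prop) (.of_forall fun x => ?_)
    rw [Real.norm_of_nonneg (by positivity)]
    exact mul_le_mul_of_nonneg_right (hTB2 x) (by positivity)
  have i4T : Integrable (fun x => u x ^ 4 * T x) := by
    refine (h2.const_mul (C * B)).mono' (by fun_prop) (.of_forall fun x => ?_)
    rw [Real.norm_eq_abs, abs_mul, abs_of_nonneg (by positivity : 0 ≤ u x ^ 4)]
    calc u x ^ 4 * |T x| ≤ C * u x ^ 2 * B :=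
          mul_le_mul (h4 x) (hTB x) (abs_nonneg _) (by positivity)
      _ = C * B * u x ^ 2 := by ring
  have iX : Integrable (fun x => u' x * u x ^ 3 * T x) := by
    refine (h2'.add i6T).mono' (by fun_prop) (.of_forall fun x => ?_)
    rw [Real.norm_eq_abs, abs_le]
    constructor <;> simp only [Pi.add_apply] <;>
      nlinarith [sq_nonneg (u' x + u x ^ 3 * T x), sq_nonneg (u' x - u x ^ 3 * T x),
        sq_nonneg (u' x), sq_nonneg (u x ^ 3 * T x)]
  have iP : Integrable (fun x => 4 * (u' x * u x ^ 3 * T x)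
      + α * (u x ^ 6 + T x ^ 2 * u x ^ 6)) :=
    (iX.const_mul 4).add ((i6.add i6T).const_mul α)
  have hparts : ∫ x, (4 * (u' x * u x ^ 3 * T x) + α * (u x ^ 6 + T x ^ 2 * u x ^ 6)) = 0 := by
    refine integral_eq_zero_of_hasDerivAt_of_integrable (f := fun x => u x ^ 4 * T x)
      (fun x => ?_) iP i4T
    refine (((hu x).fun_pow 4).fun_mul (hT' x)).congr_deriv ?_
    push_cast
    ring
  have hsq : 0 ≤ ∫ x, (u' x + α / 2 * (u x ^ 3 * T x)) ^ 2 :=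
    integral_nonneg fun _ => sq_nonneg _
  have hexp : ∫ x, (u' x + α / 2 * (u x ^ 3 * T x)) ^ 2
      = (∫ x, u' x ^ 2) + α / 4 * (∫ x, (4 * (u' x * u x ^ 3 * T x)
          + α * (u x ^ 6 + T x ^ 2 * u x ^ 6))) - α ^ 2 / 4 * ∫ x, u x ^ 6 := by
    rw [← integral_const_mul, ← integral_const_mul, ← integral_add h2' (iP.const_mul _),
      ← integral_sub (by exact h2'.add (iP.const_mul _)) (i6.const_mul _)]
    congr 1
    funext x
    ring
  rw [hexp, hparts] at hsq
  linarith

/-- Spreading a Gaussian out gives functions of any prescribed mass and arbitrarily small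
kinetic energy. -/
lemma exists_integral_sq_eq_integral_deriv_sq_lt {μ ε : ℝ} (hμ : 0 < μ) (hε : 0 < ε) :
    ∃ u u' : ℝ → ℝ, (∀ x, HasDerivAt u (u' x) x) ∧ Continuous u' ∧
      Integrable (fun x => u x ^ 2) ∧ Integrable (fun x => u' x ^ 2) ∧
      (∫ x, u x ^ 2) = μ ∧ (∫ x, u' x ^ 2) < ε := by
  set v : ℝ → ℝ := fun x => Real.exp (-2 * x ^ 2) with hv
  set w : ℝ → ℝ := fun x => 4 * (x ^ 2 * Real.exp (-2 * x ^ 2)) with hw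
  have iv : Integrable v := integrable_exp_neg_mul_sq two_pos
  have iw : Integrable w := by
    have h := integrable_rpow_mul_exp_neg_mul_sq (b := 2) two_pos (s := 2) (by norm_num)
    simp only [Real.rpow_ofNat] at h
    exact h.const_mul 4
  set M := ∫ x, v x with hM
  set K := ∫ x, w x with hK
  have hM0 : 0 < M := by
    rw [hM, hv, integral_gaussian]; positivity
  have hK0 : 0 ≤ K := integral_nonneg fun x => by positivity
  set a := μ / M with ha
  have ha0 : 0 < a := div_pos hμ hM0
  set t := √(ε / (a * K + 1)) with ht
  have ht0 : 0 < t := Real.sqrt_pos.2 (by positivity)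
  have ht2 : t ^ 2 = ε / (a * K + 1) := Real.sq_sqrt (by positivity)
  have hat : √(a * t) ^ 2 = a * t := Real.sq_sqrt (by positivity)
  have hexp : ∀ x : ℝ, Real.exp (-(t * x) ^ 2) ^ 2 = v (t * x) := fun x => by
    rw [hv, ← Real.exp_nat_mul]; congr 1; push_cast; ring
  have hu2 : (fun x => (√(a * t) * Real.exp (-(t * x) ^ 2)) ^ 2)
      = fun x => a * t * v (t * x) := by
    funext x; rw [mul_pow, hat, hexp]
  have hu2' : (fun x => (√(a * t) * (Real.exp (-(t * x) ^ 2) * (-2 * t ^ 2 * x))) ^ 2)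
      = fun x => a * t ^ 3 * w (t * x) := by
    funext x; rw [mul_pow, mul_pow, hat, hexp]; simp only [hv, hw]; ring
  refine ⟨fun x => √(a * t) * Real.exp (-(t * x) ^ 2),
    fun x => √(a * t) * (Real.exp (-(t * x) ^ 2) * (-2 * t ^ 2 * x)), fun x => ?_,
    by fun_prop, ?_, ?_, ?_, ?_⟩
  · have h : HasDerivAt (fun y : ℝ => -(t * y) ^ 2) (-2 * t ^ 2 * x) x := by
      refine (((hasDerivAt_id' x).const_mul t).fun_pow 2).fun_neg.congr_deriv ?_
      push_cast
      ring
    exact h.exp.const_mul _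
  · rw [hu2]; exact (iv.comp_mul_left' ht0.ne').const_mul _
  · rw [hu2']; exact (iw.comp_mul_left' ht0.ne').const_mul _
  · rw [hu2, integral_const_mul, Measure.integral_comp_mul_left, abs_of_pos (inv_pos.2 ht0),
      smul_eq_mul, ← hM, ha]
    field_simp
  · rw [hu2', integral_const_mul, Measure.integral_comp_mul_left, abs_of_pos (inv_pos.2 ht0),
      smul_eq_mul, ← hK]
    calc a * t ^ 3 * (t⁻¹ * K) = t ^ 2 * (a * K) := by field_simp
      _ < ε := by
        rw [ht2, div_mul_eq_mul_div, div_lt_iff₀ (by positivity)]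
        linarith


/-- For every `0 < μ ≤ μ_ℝ = √3 π / 2`, the infimum of the critical NLS energy over
admissible functions of mass `μ` on the line is zero: every continuously differentiable
`u` with `u, u'` square-integrable and `∫ u² = μ` has `E_6(u,ℝ) ≥ 0`, and for every
`ε > 0` there is such a `u` with `E_6(u,ℝ) < ε`. -/
theorem critical_energy_infimum_zero_line
    (μ : ℝ) (hμ0 : 0 < μ) (hμ : μ ≤ Real.sqrt 3 * Real.pi / 2) :
    (∀ u u' : ℝ → ℝ, (∀ x, HasDerivAt u (u' x) x) → Continuous u' →
      Integrable (fun x => u x ^ 2) → Integrable (fun x => u' x ^ 2) →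
      (∫ x, u x ^ 2) = μ →
      (1 / 2) * (∫ x, u' x ^ 2) - (1 / 6) * (∫ x, |u x| ^ 6) ≥ 0) ∧
    (∀ ε : ℝ, 0 < ε → ∃ u u' : ℝ → ℝ,
      (∀ x, HasDerivAt u (u' x) x) ∧ Continuous u' ∧
      Integrable (fun x => u x ^ 2) ∧ Integrable (fun x => u' x ^ 2) ∧
      (∫ x, u x ^ 2) = μ ∧
      (1 / 2) * (∫ x, u' x ^ 2) - (1 / 6) * (∫ x, |u x| ^ 6) < ε) := by
  refine ⟨fun u u' hu hu' h2 h2' hmass => ?_, fun ε hε => ?_⟩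
  · have h6 : (fun x => |u x| ^ 6) = fun x => u x ^ 6 :=
      funext fun x => (by decide : Even 6).pow_abs _
    rw [h6]
    have hπ : 0 < Real.pi / μ := div_pos Real.pi_pos hμ0
    have key : (Real.pi / μ) ^ 2 / 4 * (∫ x, u x ^ 6) ≤ ∫ x, u' x ^ 2 := by
      refine le_of_tendsto (x := nhdsWithin (Real.pi / μ) (Set.Iio (Real.pi / μ)))
        (f := fun α => α ^ 2 / 4 * ∫ x, u x ^ 6)
        ((by fun_prop : Continuous fun α : ℝ => α ^ 2 / 4 * ∫ x, u x ^ 6).continuousWithinAt) ?_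
      filter_upwards [self_mem_nhdsWithin, mem_nhdsWithin_of_mem_nhds (lt_mem_nhds hπ)]
        with α hα hα0
      refine sq_mul_integral_pow_six_le hu hu' h2 h2' hα0.le ?_
      rw [hmass]
      exact (lt_div_iff₀ hμ0).1 hα
    have hcrit : 1 / 3 ≤ (Real.pi / μ) ^ 2 / 4 := by
      have hμ2 : μ ^ 2 ≤ 3 * Real.pi ^ 2 / 4 :=
        calc μ ^ 2 ≤ (√3 * Real.pi / 2) ^ 2 := pow_le_pow_left₀ hμ0.le hμ 2
          _ = 3 * Real.pi ^ 2 / 4 := by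
            rw [div_pow, mul_pow, Real.sq_sqrt (by norm_num)]; norm_num
      rw [div_pow, div_div, div_le_div_iff₀ (by norm_num) (by positivity)]
      linarith
    have hI : 0 ≤ ∫ x, u x ^ 6 := integral_nonneg fun x => by positivity
    linarith [mul_le_mul_of_nonneg_right hcrit hI]
  · obtain ⟨u, u', hu, hu', h2, h2', hmass, hlt⟩ :=
      exists_integral_sq_eq_integral_deriv_sq_lt hμ0 hε
    have hI : 0 ≤ ∫ x, |u x| ^ 6 := integral_nonneg fun x => by positivity
    exact ⟨u, u', hu, hu', h2, h2', hmass, by linarith⟩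
end
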